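/- arXiv:2502.14648 — 10 statements merged into one kernel-verified Lean document; each statement's English description precedes it below -/
import Mathlib

section
/- Let f : ℝ^d → ℝ be differentiable with L-Lipschitz gradient for some L > 0, let n ≥ 1 be an integer, and let γ satisfy 0 < γ ≤ 1/(Ln). Then for any point x ∈ ℝ^d and any vectors u_0, …, u_{n−1} ∈ ℝ^d, the point y = x − γ ∑_{t=0}^{n−1} u_t satisfies f(y) ≤ f(x) − (γn/2)‖∇f(x)‖² + (γn/2)‖∇f(x) − (1/n)∑_{t=0}^{n−1} u_t‖². -/
/-- The quadratic upper bound for a differentiable function with `L`-Lipschitz gradient. -/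
theorem le_add_inner_gradient_add_sq_norm {E : Type*} [NormedAddCommGroup E]
    [InnerProductSpace ℝ E] [CompleteSpace E] {f : E → ℝ} {L : ℝ}
    (hdiff : Differentiable ℝ f)
    (hlip : ∀ x y, ‖gradient f x - gradient f y‖ ≤ L * ‖x - y‖) (x v : E) :
    f (x + v) ≤ f x + inner ℝ (gradient f x) v + L / 2 * ‖v‖ ^ 2 := by
  have hline (t : ℝ) :
      HasDerivAt (fun s : ℝ => f (x + s • v)) (inner ℝ (gradient f (x + t • v)) v) t := by
    have hg := (hdiff (x + t • v)).hasGradientAt.hasFDerivAt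
    have hv : HasDerivAt (fun s : ℝ => x + s • v) v t := by
      simpa using ((hasDerivAt_id t).smul_const v).const_add x
    exact hg.comp_hasDerivAt t hv
  have hquad (t : ℝ) :
      HasDerivAt (fun s : ℝ => f x + s * inner ℝ (gradient f x) v + L / 2 * ‖v‖ ^ 2 * s ^ 2)
        (inner ℝ (gradient f x) v + L * ‖v‖ ^ 2 * t) t := by
    refine ((((hasDerivAt_id t).mul_const (inner ℝ (gradient f x) v)).const_add (f x)).add
      ((hasDerivAt_pow 2 t).const_mul (L / 2 * ‖v‖ ^ 2))).congr_deriv ?_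
    push_cast
    ring
  have key := image_le_of_deriv_right_le_deriv_boundary (a := 0) (b := 1)
    (fun t _ => (hline t).continuousAt.continuousWithinAt)
    (fun t _ => (hline t).hasDerivWithinAt) (by simp)
    (fun t _ => (hquad t).continuousAt.continuousWithinAt)
    (fun t _ => (hquad t).hasDerivWithinAt)
    (fun t ht => by
      have hle : inner ℝ (gradient f (x + t • v) - gradient f x) v ≤ L * ‖v‖ ^ 2 * t :=
        calc inner ℝ (gradient f (x + t • v) - gradient f x) v
            ≤ ‖gradient f (x + t • v) - gradient f x‖ * ‖v‖ := real_inner_le_norm _ _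
          _ ≤ L * ‖x + t • v - x‖ * ‖v‖ := by gcongr; exact hlip _ _
          _ = L * ‖v‖ ^ 2 * t := by
            rw [add_sub_cancel_left, norm_smul, Real.norm_of_nonneg ht.1]
            ring
      rw [inner_sub_left] at hle
      linarith)
    (Set.right_mem_Icc.2 zero_le_one)
  simpa using key

/-- Descent lemma for one NFG-SVRG epoch step: for an `L`-smooth function `f`,
an aggregate step `y = x - γ ∑ u_t` with `0 < γ ≤ 1/(L n)` satisfies the
one-epoch descent inequality. -/
theorem nfg_svrg_descent_lemma {d : ℕ} (hd : 1 ≤ d)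
    (f : EuclideanSpace ℝ (Fin d) → ℝ) (L : ℝ) (hL : 0 < L)
    (hdiff : Differentiable ℝ f)
    (hlip : ∀ x y, ‖gradient f x - gradient f y‖ ≤ L * ‖x - y‖)
    (n : ℕ) (hn : 1 ≤ n) (γ : ℝ) (hγ0 : 0 < γ) (hγ : γ ≤ 1 / (L * n))
    (x : EuclideanSpace ℝ (Fin d)) (u : Fin n → EuclideanSpace ℝ (Fin d)) :
    f (x - γ • ∑ t, u t) ≤
      f x - (γ * n / 2) * ‖gradient f x‖ ^ 2
        + (γ * n / 2) * ‖gradient f x - (1 / (n : ℝ)) • ∑ t, u t‖ ^ 2 := by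
  have hn0 : (0 : ℝ) < n := by exact_mod_cast hn
  have hstep : L * (γ * n) ≤ 1 := by
    rw [le_div_iff₀ (by positivity)] at hγ
    linarith
  set w := (1 / (n : ℝ)) • ∑ t, u t with hw
  have hsum : γ • ∑ t, u t = (γ * n) • w := by
    rw [hw, smul_smul]
    congr 1
    field_simp
  have hdesc := le_add_inner_gradient_add_sq_norm hdiff hlip x (-((γ * n) • w))
  rw [← sub_eq_add_neg, inner_neg_right, real_inner_smul_right, norm_neg, norm_smul,
    Real.norm_of_nonneg (by positivity)] at hdesc
  rw [hsum, norm_sub_sq_real]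
  have hsq : 0 ≤ (1 - L * (γ * n)) * (γ * n * ‖w‖ ^ 2) :=
    mul_nonneg (sub_nonneg.2 hstep) (by positivity)
  linarith
end

section
/- Consider one NFG-SVRG epoch with stepsize γ satisfying 0 < γ ≤ 1/(2Ln). Then the iterates satisfy ∑_{t=0}^{n−1} ‖x^t − ω‖² ≤ 4γ²n³‖v‖². -/
/-- A discrete Grönwall bound: a perturbed recursion with growth rate `a ≤ 1 / (2 n)` grows at most
twice as fast as the unperturbed one over the first `n` steps. -/
theorem le_two_mul_of_le_one_add_mul_add {e : ℕ → ℝ} {a b : ℝ} {n : ℕ} (ha : 0 ≤ a) (hb : 0 ≤ b)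
    (han : 2 * a * n ≤ 1) (h0 : e 0 ≤ 0) (he : ∀ t < n, e (t + 1) ≤ (1 + a) * e t + b) :
    ∀ t ≤ n, e t ≤ 2 * t * b := by
  intro t
  induction t with
  | zero => simpa using h0
  | succ t ih =>
    intro ht
    have hta : 2 * a * t ≤ 1 :=
      le_trans (by gcongr; omega) han
    calc e (t + 1) ≤ (1 + a) * e t + b := he t ht
      _ ≤ (1 + a) * (2 * t * b) + b := by gcongr; exact ih (by omega)
      _ = 2 * t * b + (2 * a * t) * b + b := by ring
      _ ≤ 2 * t * b + 1 * b + b := by gcongr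
      _ = 2 * (t + 1 : ℕ) * b := by push_cast; ring

/-- In one NFG-SVRG epoch with stepsize `0 < γ ≤ 1/(2 L n)`, the iterates stay
close to the reference point: `∑_{t=0}^{n-1} ‖x^t - ω‖² ≤ 4 γ² n³ ‖v‖²`. -/
theorem nfg_svrg_iterate_drift {n d : ℕ} (hn : 1 ≤ n) (hd : 1 ≤ d)
    (L : ℝ) (hL : 0 < L)
    (F : Fin n → EuclideanSpace ℝ (Fin d) → ℝ)
    (hdiff : ∀ i, Differentiable ℝ (F i))
    (hlip : ∀ i x y, ‖gradient (F i) x - gradient (F i) y‖ ≤ L * ‖x - y‖)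
    (γ : ℝ) (hγ0 : 0 < γ) (hγ : γ ≤ 1 / (2 * L * n))
    (ω v : EuclideanSpace ℝ (Fin d)) (π : Equiv.Perm (Fin n))
    (x : ℕ → EuclideanSpace ℝ (Fin d)) (vt : ℕ → EuclideanSpace ℝ (Fin d))
    (hx0 : x 0 = ω)
    (hvt : ∀ t (ht : t < n),
      vt t = gradient (F (π ⟨t, ht⟩)) (x t) - gradient (F (π ⟨t, ht⟩)) ω + v)
    (hxt : ∀ t, t < n → x (t + 1) = x t - γ • vt t) :
    ∑ t ∈ Finset.range n, ‖x t - ω‖ ^ 2 ≤ 4 * γ ^ 2 * (n : ℝ) ^ 3 * ‖v‖ ^ 2 := by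
  have hn0 : (0 : ℝ) < n := by exact_mod_cast hn
  have han : 2 * (γ * L) * n ≤ 1 := by
    rw [le_div_iff₀ (by positivity)] at hγ
    linarith
  have hstep : ∀ t < n, ‖x (t + 1) - ω‖ ≤ (1 + γ * L) * ‖x t - ω‖ + γ * ‖v‖ := by
    intro t ht
    have hv : ‖vt t‖ ≤ L * ‖x t - ω‖ + ‖v‖ := by
      rw [hvt t ht]
      exact (norm_add_le _ _).trans (by gcongr; exact hlip _ _ _)
    calc ‖x (t + 1) - ω‖ = ‖(x t - ω) - γ • vt t‖ := by rw [hxt t ht, sub_right_comm]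
      _ ≤ ‖x t - ω‖ + γ * ‖vt t‖ := by
        simpa [norm_smul, abs_of_pos hγ0] using norm_sub_le (x t - ω) (γ • vt t)
      _ ≤ ‖x t - ω‖ + γ * (L * ‖x t - ω‖ + ‖v‖) := by gcongr
      _ = (1 + γ * L) * ‖x t - ω‖ + γ * ‖v‖ := by ring
  have hbound := le_two_mul_of_le_one_add_mul_add (e := fun t => ‖x t - ω‖)
    (by positivity) (by positivity) han (by simp [hx0]) hstep
  calc ∑ t ∈ Finset.range n, ‖x t - ω‖ ^ 2
      ≤ ∑ _t ∈ Finset.range n, (2 * n * (γ * ‖v‖)) ^ 2 := by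
        refine Finset.sum_le_sum fun t ht => ?_
        have htn : t ≤ n := (Finset.mem_range.1 ht).le
        gcongr
        exact (hbound t htn).trans (by gcongr)
    _ = 4 * γ ^ 2 * (n : ℝ) ^ 3 * ‖v‖ ^ 2 := by
      rw [Finset.sum_const, Finset.card_range, nsmul_eq_mul]
      ring
end

section
/- Consider one NFG-SVRG epoch with stepsize γ satisfying 0 < γ ≤ 1/(2Ln). Then the endpoint of the epoch satisfies ‖x^n − ω‖² ≤ 4γ²n²‖v‖². -/
/-- A linearly perturbed recursion `a (t + 1) ≤ a t + γ (L a t + V)` started at `0` grows at most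
like `2 γ t V` over a horizon `n` with `2 γ L n ≤ 1`. -/
theorem le_two_mul_of_perturbed_recursion {n : ℕ} {L γ V : ℝ} {a : ℕ → ℝ} (hL : 0 ≤ L)
    (hγ0 : 0 ≤ γ) (hV : 0 ≤ V) (hγ : 2 * (γ * L * n) ≤ 1) (h0 : a 0 ≤ 0)
    (ha : ∀ t < n, a (t + 1) ≤ a t + γ * (L * a t + V)) :
    ∀ t ≤ n, a t ≤ 2 * γ * t * V := by
  intro t
  induction t with
  | zero => simpa using h0
  | succ t ih =>
    intro ht
    have hat := ih (by lia)
    have htn : (t : ℝ) ≤ n := by exact_mod_cast (by lia : t ≤ n)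
    have hsmall : 2 * (γ * L * t) ≤ 1 := le_trans (by gcongr) hγ
    calc a (t + 1) ≤ a t + γ * (L * a t + V) := ha t (by lia)
      _ ≤ 2 * γ * t * V + γ * (L * (2 * γ * t * V) + V) := by gcongr
      _ = 2 * γ * t * V + γ * V + 2 * (γ * L * t) * (γ * V) := by ring
      _ ≤ 2 * γ * t * V + γ * V + 1 * (γ * V) := by gcongr
      _ = 2 * γ * (t + 1 : ℕ) * V := by push_cast; ring

/-- In one NFG-SVRG epoch with stepsize `0 < γ ≤ 1/(2 L n)`, the endpoint of
the epoch satisfies `‖x^n - ω‖² ≤ 4 γ² n² ‖v‖²`. -/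
theorem nfg_svrg_epoch_endpoint {n d : ℕ} (hn : 1 ≤ n) (hd : 1 ≤ d)
    (L : ℝ) (hL : 0 < L)
    (F : Fin n → EuclideanSpace ℝ (Fin d) → ℝ)
    (hdiff : ∀ i, Differentiable ℝ (F i))
    (hlip : ∀ i x y, ‖gradient (F i) x - gradient (F i) y‖ ≤ L * ‖x - y‖)
    (γ : ℝ) (hγ0 : 0 < γ) (hγ : γ ≤ 1 / (2 * L * n))
    (ω v : EuclideanSpace ℝ (Fin d)) (π : Equiv.Perm (Fin n))
    (x : ℕ → EuclideanSpace ℝ (Fin d)) (vt : ℕ → EuclideanSpace ℝ (Fin d))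
    (hx0 : x 0 = ω)
    (hvt : ∀ t (ht : t < n),
      vt t = gradient (F (π ⟨t, ht⟩)) (x t) - gradient (F (π ⟨t, ht⟩)) ω + v)
    (hxt : ∀ t, t < n → x (t + 1) = x t - γ • vt t) :
    ‖x n - ω‖ ^ 2 ≤ 4 * γ ^ 2 * (n : ℝ) ^ 2 * ‖v‖ ^ 2 := by
  have hn0 : (0 : ℝ) < n := by exact_mod_cast hn
  have hsmall : 2 * (γ * L * n) ≤ 1 := by
    rw [le_div_iff₀ (by positivity)] at hγ
    linarith
  have hstep : ∀ t < n, ‖x (t + 1) - ω‖ ≤ ‖x t - ω‖ + γ * (L * ‖x t - ω‖ + ‖v‖) := by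
    intro t ht
    have hvt_le : ‖vt t‖ ≤ L * ‖x t - ω‖ + ‖v‖ := by
      rw [hvt t ht]
      exact (norm_add_le _ _).trans (by gcongr; exact hlip _ _ _)
    calc ‖x (t + 1) - ω‖ = ‖(x t - ω) - γ • vt t‖ := by rw [hxt t ht, sub_right_comm]
      _ ≤ ‖x t - ω‖ + ‖γ • vt t‖ := norm_sub_le _ _
      _ = ‖x t - ω‖ + γ * ‖vt t‖ := by rw [norm_smul, Real.norm_of_nonneg hγ0.le]
      _ ≤ ‖x t - ω‖ + γ * (L * ‖x t - ω‖ + ‖v‖) := by gcongr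
  have hend : ‖x n - ω‖ ≤ 2 * γ * n * ‖v‖ :=
    le_two_mul_of_perturbed_recursion (a := fun t => ‖x t - ω‖) hL.le hγ0.le (norm_nonneg v)
      hsmall (by simp [hx0]) hstep n le_rfl
  calc ‖x n - ω‖ ^ 2 ≤ (2 * γ * n * ‖v‖) ^ 2 := by gcongr
    _ = 4 * γ ^ 2 * (n : ℝ) ^ 2 * ‖v‖ ^ 2 := by ring
end

section
/- Consider two consecutive NFG-SVRG epochs with stepsize γ satisfying 0 < γ ≤ 1/(2Ln): an earlier epoch with reference point ω' ∈ ℝ^d, arbitrary gradient estimate v' ∈ ℝ^d and permutation π' producing iterates x'^0 = ω', …, x'^n, followed by the current epoch with reference point ω = x'^n, gradient estimate v = (1/n)∑_{t=0}^{n−1} ∇f_{π'(t)}(x'^t) and permutation π producing iterates x^0 = ω, …, x^n and estimators v^0, …, v^{n−1}. Then ‖∇f(ω) − (1/n)∑_{t=0}^{n−1} v^t‖² ≤ 8γ²L²n²‖v‖² + 32γ²L²n²‖v'‖². -/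
/-- The gradient of a finite average of differentiable functions is the average of the gradients. -/
theorem gradient_const_mul_sum {ι E : Type*} [NormedAddCommGroup E] [InnerProductSpace ℝ E]
    [CompleteSpace E] (s : Finset ι) (c : ℝ) (F : ι → E → ℝ) (z : E)
    (hF : ∀ i ∈ s, DifferentiableAt ℝ (F i) z) :
    gradient (fun y => c * ∑ i ∈ s, F i y) z = c • ∑ i ∈ s, gradient (F i) z := by
  simp only [gradient]
  rw [fderiv_const_mul (DifferentiableAt.fun_sum hF), fderiv_fun_sum hF]
  simp

/-- If each step of a sequence is at most `γ * (L * ‖x t - x 0‖ + c)` during the first `n` steps and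
`2 * γ * L * n ≤ 1`, then every one of these steps is at most `2 * γ * c`, so that any two of the
first `n + 1` terms are correspondingly close. -/
theorem norm_sub_le_of_norm_step_le {E : Type*} [NormedAddCommGroup E] {n : ℕ} {γ L c : ℝ}
    (hγ : 0 ≤ γ) (hL : 0 ≤ L) (hc : 0 ≤ c) (hγL : 2 * γ * L * n ≤ 1) {x : ℕ → E}
    (hstep : ∀ t < n, ‖x (t + 1) - x t‖ ≤ γ * (L * ‖x t - x 0‖ + c))
    {s t : ℕ} (hst : s ≤ t) (htn : t ≤ n) : ‖x t - x s‖ ≤ 2 * γ * c * n := by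
  have hγc : 0 ≤ γ * c := mul_nonneg hγ hc
  have step_le {t : ℕ} (ht : t < n) (h : ‖x t - x 0‖ ≤ 2 * γ * c * t) :
      ‖x (t + 1) - x t‖ ≤ 2 * γ * c := by
    have htn : (t : ℝ) ≤ n := by exact_mod_cast ht.le
    have h1 : 2 * γ * L * t ≤ 1 :=
      (mul_le_mul_of_nonneg_left htn (by positivity)).trans hγL
    calc ‖x (t + 1) - x t‖ ≤ γ * (L * ‖x t - x 0‖ + c) := hstep t ht
      _ ≤ γ * (L * (2 * γ * c * t) + c) := by gcongr
      _ = γ * c * (2 * γ * L * t + 1) := by ring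
      _ ≤ γ * c * (1 + 1) := by gcongr
      _ = 2 * γ * c := by ring
  have from_zero : ∀ t ≤ n, ‖x t - x 0‖ ≤ 2 * γ * c * t := by
    intro t
    induction t with
    | zero => simp
    | succ t ih =>
      intro ht
      have h := ih (by omega)
      have := norm_sub_le_norm_sub_add_norm_sub (x (t + 1)) (x t) (x 0)
      have := step_le ht h
      push_cast
      linarith
  have key : ‖x t - x s‖ ≤ 2 * γ * c * ((t : ℝ) - s) := by
    induction t, hst using Nat.le_induction with
    | base => simp
    | succ t _ ih =>
      have h := ih (by omega)
      have := norm_sub_le_norm_sub_add_norm_sub (x (t + 1)) (x t) (x s)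
      have := step_le htn (from_zero t (by omega))
      push_cast
      linarith
  refine key.trans ?_
  have hs : (0 : ℝ) ≤ s := s.cast_nonneg
  have ht : (t : ℝ) ≤ n := by exact_mod_cast htn
  gcongr
  linarith

/-- Along the iterates of an epoch any two iterates are within `2 * γ * ‖v‖ * n`. -/
theorem norm_sub_le_of_epoch {E : Type*} [NormedAddCommGroup E] [NormedSpace ℝ E] {n : ℕ}
    {γ L : ℝ} (hγ : 0 ≤ γ) (hL : 0 ≤ L) (hγL : 2 * γ * L * n ≤ 1) {g : Fin n → E → E}
    (hg : ∀ i x y, ‖g i x - g i y‖ ≤ L * ‖x - y‖) {v : E} {x u : ℕ → E}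
    (hu : ∀ t (ht : t < n), u t = g ⟨t, ht⟩ (x t) - g ⟨t, ht⟩ (x 0) + v)
    (hx : ∀ t < n, x (t + 1) = x t - γ • u t) {s t : ℕ} (hst : s ≤ t) (htn : t ≤ n) :
    ‖x t - x s‖ ≤ 2 * γ * ‖v‖ * n := by
  refine norm_sub_le_of_norm_step_le hγ hL (norm_nonneg v) hγL (fun t ht => ?_) hst htn
  rw [hx t ht, sub_sub_cancel_left, norm_neg, norm_smul, Real.norm_of_nonneg hγ, hu t ht]
  gcongr
  exact (norm_add_le _ _).trans (by gcongr; exact hg _ _ _)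

/-- The average of vectors of norm at most `C` has norm at most `C`. -/
theorem norm_average_le {E : Type*} [NormedAddCommGroup E] [NormedSpace ℝ E] {n : ℕ}
    (hn : 1 ≤ n) {a : Fin n → E} {C : ℝ} (ha : ∀ i, ‖a i‖ ≤ C) :
    ‖(1 / (n : ℝ)) • ∑ i, a i‖ ≤ C := by
  have hn' : (0 : ℝ) < n := by exact_mod_cast hn
  have h : ‖∑ i, a i‖ ≤ n * C := by
    simpa using norm_sum_le_of_le Finset.univ fun i _ => ha i
  rw [norm_smul, Real.norm_of_nonneg (by positivity), one_div_mul_eq_div, div_le_iff₀' hn']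
  exact h

/-- Lemma 3 (NFG-SVRG): for two consecutive NFG-SVRG epochs with stepsize
`0 < γ ≤ 1/(2 L n)`, the discrepancy between the true gradient at the current
reference point and the average of the current epoch's estimators is bounded by
`8 γ² L² n² ‖v‖² + 32 γ² L² n² ‖v'‖²`. -/
theorem nfg_svrg_two_epoch_bound {n d : ℕ} (hn : 1 ≤ n) (hd : 1 ≤ d)
    (L : ℝ) (hL : 0 < L)
    (F : Fin n → EuclideanSpace ℝ (Fin d) → ℝ)
    (hdiff : ∀ i, Differentiable ℝ (F i))
    (hlip : ∀ i x y, ‖gradient (F i) x - gradient (F i) y‖ ≤ L * ‖x - y‖)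
    (f : EuclideanSpace ℝ (Fin d) → ℝ)
    (hf : ∀ z, f z = (1 / (n : ℝ)) * ∑ i, F i z)
    (γ : ℝ) (hγ0 : 0 < γ) (hγ : γ ≤ 1 / (2 * L * n))
    -- earlier epoch
    (ω' v' : EuclideanSpace ℝ (Fin d)) (π' : Equiv.Perm (Fin n))
    (x' : ℕ → EuclideanSpace ℝ (Fin d)) (vt' : ℕ → EuclideanSpace ℝ (Fin d))
    (hx'0 : x' 0 = ω')
    (hvt' : ∀ t (ht : t < n),
      vt' t = gradient (F (π' ⟨t, ht⟩)) (x' t) - gradient (F (π' ⟨t, ht⟩)) ω' + v')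
    (hx't : ∀ t, t < n → x' (t + 1) = x' t - γ • vt' t)
    -- current epoch
    (ω v : EuclideanSpace ℝ (Fin d)) (π : Equiv.Perm (Fin n))
    (hω : ω = x' n)
    (hv : v = (1 / (n : ℝ)) • ∑ t : Fin n, gradient (F (π' t)) (x' t))
    (x : ℕ → EuclideanSpace ℝ (Fin d)) (vt : ℕ → EuclideanSpace ℝ (Fin d))
    (hx0 : x 0 = ω)
    (hvt : ∀ t (ht : t < n),
      vt t = gradient (F (π ⟨t, ht⟩)) (x t) - gradient (F (π ⟨t, ht⟩)) ω + v)
    (hxt : ∀ t, t < n → x (t + 1) = x t - γ • vt t) :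
    ‖gradient f ω - (1 / (n : ℝ)) • ∑ t ∈ Finset.range n, vt t‖ ^ 2 ≤
      8 * γ ^ 2 * L ^ 2 * (n : ℝ) ^ 2 * ‖v‖ ^ 2
        + 32 * γ ^ 2 * L ^ 2 * (n : ℝ) ^ 2 * ‖v'‖ ^ 2 := by
  have hn' : (0 : ℝ) < n := by exact_mod_cast hn
  have hγL : 2 * γ * L * n ≤ 1 := by
    rw [le_div_iff₀ (by positivity)] at hγ
    linarith
  obtain rfl : f = fun z => (1 / (n : ℝ)) * ∑ i, F i z := funext hf
  subst hx'0
  have hgrad : gradient (fun z => (1 / (n : ℝ)) * ∑ i, F i z) ω =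
      (1 / (n : ℝ)) • ∑ t, gradient (F (π' t)) ω := by
    rw [gradient_const_mul_sum _ _ _ _ fun i _ => hdiff i ω,
      Equiv.sum_comp π' fun i => gradient (F i) ω]
  have havg : (1 / (n : ℝ)) • ∑ t ∈ Finset.range n, vt t =
      (1 / (n : ℝ)) • ∑ t : Fin n, (gradient (F (π t)) (x t) - gradient (F (π t)) ω) + v := by
    rw [Finset.sum_range, Finset.sum_congr rfl fun (t : Fin n) _ => hvt t t.2, Finset.sum_add_distrib,
      smul_add]
    simp [← Nat.cast_smul_eq_nsmul ℝ, smul_smul, hn'.ne']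
  have hsplit : gradient (fun z => (1 / (n : ℝ)) * ∑ i, F i z) ω -
        (1 / (n : ℝ)) • ∑ t ∈ Finset.range n, vt t =
      (1 / (n : ℝ)) • ∑ t : Fin n, (gradient (F (π' t)) ω - gradient (F (π' t)) (x' t)) -
      (1 / (n : ℝ)) • ∑ t : Fin n, (gradient (F (π t)) (x t) - gradient (F (π t)) ω) := by
    rw [hgrad, havg, Finset.sum_sub_distrib (s := Finset.univ)
      (fun t => gradient (F (π' t)) ω), smul_sub, ← hv]
    abel
  have hprev : ‖(1 / (n : ℝ)) • ∑ t : Fin n,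
      (gradient (F (π' t)) ω - gradient (F (π' t)) (x' t))‖ ≤ L * (2 * γ * ‖v'‖ * n) := by
    refine norm_average_le hn fun t => (hlip _ _ _).trans ?_
    rw [hω]
    gcongr
    exact norm_sub_le_of_epoch hγ0.le hL.le hγL (g := fun i => gradient (F (π' i)))
      (fun i => hlip (π' i)) hvt' hx't t.2.le le_rfl
  have hcur : ‖(1 / (n : ℝ)) • ∑ t : Fin n,
      (gradient (F (π t)) (x t) - gradient (F (π t)) ω)‖ ≤ L * (2 * γ * ‖v‖ * n) := by
    rw [← hx0] at hvt ⊢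
    refine norm_average_le hn fun t => (hlip _ _ _).trans ?_
    gcongr
    exact norm_sub_le_of_epoch hγ0.le hL.le hγL (g := fun i => gradient (F (π i)))
      (fun i => hlip (π i)) hvt hxt (Nat.zero_le _) t.2.le
  rw [hsplit]
  calc _ ≤ (L * (2 * γ * ‖v'‖ * n) + L * (2 * γ * ‖v‖ * n)) ^ 2 := by
        gcongr
        exact (norm_sub_le _ _).trans (add_le_add hprev hcur)
    _ ≤ 2 * ((L * (2 * γ * ‖v'‖ * n)) ^ 2 + (L * (2 * γ * ‖v‖ * n)) ^ 2) := add_sq_le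
    _ = 8 * γ ^ 2 * L ^ 2 * (n : ℝ) ^ 2 * ‖v‖ ^ 2
        + 8 * γ ^ 2 * L ^ 2 * (n : ℝ) ^ 2 * ‖v'‖ ^ 2 := by ring
    _ ≤ _ := by gcongr; norm_num
end

section
/- Under the NFG-SARAH epoch recursion for the gradient estimators (with the points x^0, …, x^n arbitrary), one has ‖∇f(x^0) − (1/(n+1))∑_{t=0}^{n} v^t‖² ≤ 2‖∇f(x^0) − v‖² + (2L²/(n+1))∑_{t=1}^{n} ‖x^t − x^{t−1}‖². -/
/-- Along a recursion with increments of norm at most `a t`, the iterates stay within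
`∑ t ∈ range n, a t` of the starting point. -/
theorem norm_sub_zero_le_sum_of_norm_step_le {E : Type*} [SeminormedAddCommGroup E] {n : ℕ}
    {u : ℕ → E} {a : ℕ → ℝ} (ha : ∀ t, 0 ≤ a t) (hu : ∀ t < n, ‖u (t + 1) - u t‖ ≤ a t)
    {t : ℕ} (ht : t ≤ n) : ‖u t - u 0‖ ≤ ∑ s ∈ Finset.range n, a s := by
  rw [← Finset.sum_range_sub]
  calc ‖∑ s ∈ Finset.range t, (u (s + 1) - u s)‖
      ≤ ∑ s ∈ Finset.range t, a s :=
        norm_sum_le_of_le _ fun s hs => hu s ((Finset.mem_range.1 hs).trans_le ht)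
    _ ≤ ∑ s ∈ Finset.range n, a s :=
        Finset.sum_le_sum_of_subset_of_nonneg (Finset.range_mono ht) fun s _ _ => ha s

/-- If the iterates `u 0, …, u n` move by at most `(L / n) * b t` at step `t`, then their average
is within `L / √(n + 1)` times the `ℓ²` norm of `b` of the starting point. -/
theorem norm_sq_sub_average_le {E : Type*} [SeminormedAddCommGroup E] [NormedSpace ℝ E] {n : ℕ}
    (hn : 1 ≤ n) {L : ℝ} (hL : 0 ≤ L) {u : ℕ → E} {b : ℕ → ℝ} (hb : ∀ t, 0 ≤ b t)
    (hu : ∀ t < n, ‖u (t + 1) - u t‖ ≤ L / n * b t) :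
    ‖u 0 - (1 / ((n : ℝ) + 1)) • ∑ t ∈ Finset.range (n + 1), u t‖ ^ 2 ≤
      L ^ 2 / ((n : ℝ) + 1) * ∑ t ∈ Finset.range n, b t ^ 2 := by
  have hn' : (0 : ℝ) < n := by exact_mod_cast hn
  have hn1 : (0 : ℝ) < (n : ℝ) + 1 := by positivity
  set B := ∑ t ∈ Finset.range n, b t with hB
  have hsum : ‖∑ t ∈ Finset.range (n + 1), (u t - u 0)‖ ≤ L * B := by
    rw [Finset.sum_range_succ', sub_self, add_zero]
    calc ‖∑ t ∈ Finset.range n, (u (t + 1) - u 0)‖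
        ≤ ∑ _t ∈ Finset.range n, L / n * B := by
          refine norm_sum_le_of_le _ fun t ht => ?_
          rw [hB, Finset.mul_sum]
          exact norm_sub_zero_le_sum_of_norm_step_le (a := fun s => L / n * b s)
            (fun s => mul_nonneg (by positivity) (hb s)) hu (Finset.mem_range.1 ht)
      _ = L * B := by
          rw [Finset.sum_const, Finset.card_range, nsmul_eq_mul]
          field_simp
  have havg : u 0 - (1 / ((n : ℝ) + 1)) • ∑ t ∈ Finset.range (n + 1), u t =
      -((1 / ((n : ℝ) + 1)) • ∑ t ∈ Finset.range (n + 1), (u t - u 0)) := by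
    rw [Finset.sum_sub_distrib, Finset.sum_const, Finset.card_range, ← Nat.cast_smul_eq_nsmul ℝ,
      smul_sub, smul_smul, Nat.cast_add_one, one_div_mul_cancel hn1.ne', one_smul, neg_sub]
  have hcs : B ^ 2 ≤ n * ∑ t ∈ Finset.range n, b t ^ 2 := by
    simpa using sq_sum_le_card_mul_sum_sq (s := Finset.range n) (f := b)
  have hS : 0 ≤ ∑ t ∈ Finset.range n, b t ^ 2 := Finset.sum_nonneg fun t _ => sq_nonneg _
  rw [havg, norm_neg, norm_smul, mul_pow, Real.norm_of_nonneg (by positivity)]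
  calc (1 / ((n : ℝ) + 1)) ^ 2 * ‖∑ t ∈ Finset.range (n + 1), (u t - u 0)‖ ^ 2
      ≤ (1 / ((n : ℝ) + 1)) ^ 2 * (L * B) ^ 2 := by gcongr
    _ = L ^ 2 / ((n : ℝ) + 1) ^ 2 * B ^ 2 := by field_simp
    _ ≤ L ^ 2 / ((n : ℝ) + 1) ^ 2 * (((n : ℝ) + 1) * ∑ t ∈ Finset.range n, b t ^ 2) := by
        gcongr
        exact hcs.trans (by gcongr; linarith)
    _ = L ^ 2 / ((n : ℝ) + 1) * ∑ t ∈ Finset.range n, b t ^ 2 := by field_simp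

/-- Lemma 5 (NFG-SARAH): bound on the distance between the true gradient at the
epoch's starting point `x^0` and the average of the SARAH-style recursive
estimators built during an epoch (with arbitrary points `x^0, …, x^n`). -/
theorem nfg_sarah_estimator_bound {n d : ℕ} (hn : 1 ≤ n) (hd : 1 ≤ d)
    (L : ℝ) (hL : 0 < L)
    (F : Fin n → EuclideanSpace ℝ (Fin d) → ℝ)
    (hdiff : ∀ i, Differentiable ℝ (F i))
    (hlip : ∀ i x y, ‖gradient (F i) x - gradient (F i) y‖ ≤ L * ‖x - y‖)
    (f : EuclideanSpace ℝ (Fin d) → ℝ)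
    (hf : ∀ z, f z = (1 / (n : ℝ)) * ∑ i, F i z)
    (v : EuclideanSpace ℝ (Fin d)) (π : Equiv.Perm (Fin n))
    (x : ℕ → EuclideanSpace ℝ (Fin d)) (vt : ℕ → EuclideanSpace ℝ (Fin d))
    (hvt0 : vt 0 = v)
    (hvt : ∀ t (ht : t < n),
      vt (t + 1) = vt t + (1 / (n : ℝ)) •
        (gradient (F (π ⟨t, ht⟩)) (x (t + 1)) - gradient (F (π ⟨t, ht⟩)) (x t))) :
    ‖gradient f (x 0) - (1 / ((n : ℝ) + 1)) • ∑ t ∈ Finset.range (n + 1), vt t‖ ^ 2 ≤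
      2 * ‖gradient f (x 0) - v‖ ^ 2
        + (2 * L ^ 2 / ((n : ℝ) + 1)) * ∑ t ∈ Finset.Icc 1 n, ‖x t - x (t - 1)‖ ^ 2 := by
  have hstep : ∀ t < n, ‖vt (t + 1) - vt t‖ ≤ L / n * ‖x (t + 1) - x t‖ := by
    intro t ht
    rw [hvt t ht, add_sub_cancel_left, norm_smul, Real.norm_of_nonneg (by positivity)]
    calc (1 / (n : ℝ)) * ‖gradient (F (π ⟨t, ht⟩)) (x (t + 1)) - gradient (F (π ⟨t, ht⟩)) (x t)‖
        ≤ (1 / (n : ℝ)) * (L * ‖x (t + 1) - x t‖) := by gcongr; exact hlip _ _ _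
      _ = L / n * ‖x (t + 1) - x t‖ := by ring
  have havg := norm_sq_sub_average_le hn hL.le (fun t => norm_nonneg (x (t + 1) - x t)) hstep
  have hIcc : ∑ t ∈ Finset.Icc 1 n, ‖x t - x (t - 1)‖ ^ 2 =
      ∑ t ∈ Finset.range n, ‖x (t + 1) - x t‖ ^ 2 := by
    rw [Finset.range_eq_Ico]
    exact (Finset.sum_Ico_add' (fun t => ‖x t - x (t - 1)‖ ^ 2) 0 n 1).symm
  rw [hvt0] at havg
  rw [hIcc, ← sub_add_sub_cancel (gradient f (x 0)) v]
  calc _ ≤ (‖gradient f (x 0) - v‖ +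
        ‖v - (1 / ((n : ℝ) + 1)) • ∑ t ∈ Finset.range (n + 1), vt t‖) ^ 2 := by
        gcongr
        exact norm_add_le _ _
    _ ≤ 2 * (‖gradient f (x 0) - v‖ ^ 2 +
        ‖v - (1 / ((n : ℝ) + 1)) • ∑ t ∈ Finset.range (n + 1), vt t‖ ^ 2) := add_sq_le
    _ ≤ 2 * (‖gradient f (x 0) - v‖ ^ 2 +
        L ^ 2 / ((n : ℝ) + 1) * ∑ t ∈ Finset.range n, ‖x (t + 1) - x t‖ ^ 2) := by gcongr
    _ = _ := by ring
end

section
/- Under the NFG-SARAH epoch recursion for the gradient estimators (with the points x^0, …, x^n arbitrary), for every t with 0 ≤ t ≤ n−1 one has ‖v^t‖² ≤ e‖v^0‖² + (eL²/n) ∑_{k=1}^{t} ‖x^k − x^{k−1}‖², where e = exp(1) is Euler's number. -/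
/-- Young's inequality in the form `(a + b/n)² ≤ (1 + 1/n) (a² + b²/n)`. -/
theorem add_div_sq_le_one_add_inv_mul {n : ℝ} (hn : 0 < n) (a b : ℝ) :
    (a + b / n) ^ 2 ≤ (1 + 1 / n) * (a ^ 2 + b ^ 2 / n) := by
  have h : (1 + 1 / n) * (a ^ 2 + b ^ 2 / n) - (a + b / n) ^ 2 = (a - b) ^ 2 / n := by
    field_simp
    ring
  have : 0 ≤ (a - b) ^ 2 / n := by positivity
  linarith

/-- A discrete Grönwall inequality: if `a (t + 1) ≤ q (a t + b (t + 1))` for `t < n`, with `1 ≤ q`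
and `b` nonnegative, then `a t ≤ q ^ t (a 0 + ∑_{k = 1}^t b k)` for `t ≤ n`. -/
theorem le_pow_mul_add_sum_of_le_mul_add {a b : ℕ → ℝ} {q : ℝ} {n : ℕ} (hq : 1 ≤ q)
    (hb : ∀ k, 0 ≤ b k) (h : ∀ t < n, a (t + 1) ≤ q * (a t + b (t + 1))) :
    ∀ t ≤ n, a t ≤ q ^ t * (a 0 + ∑ k ∈ Finset.Icc 1 t, b k) := by
  intro t
  induction t with
  | zero => simp
  | succ t ih =>
    intro ht
    calc a (t + 1) ≤ q * (a t + b (t + 1)) := h t ht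
      _ ≤ q * (q ^ t * (a 0 + ∑ k ∈ Finset.Icc 1 t, b k) + q ^ t * b (t + 1)) := by
        gcongr
        · exact ih (by omega)
        · exact le_mul_of_one_le_left (hb _) (one_le_pow₀ hq)
      _ = q ^ (t + 1) * (a 0 + ∑ k ∈ Finset.Icc 1 (t + 1), b k) := by
        rw [Finset.sum_Icc_succ_top (by omega)]
        ring

theorem one_add_one_div_pow_le_exp_one {n t : ℕ} (hn : 0 < n) (ht : t ≤ n) :
    (1 + 1 / (n : ℝ)) ^ t ≤ Real.exp 1 := by
  have hn' : (0 : ℝ) < n := by exact_mod_cast hn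
  calc (1 + 1 / (n : ℝ)) ^ t ≤ (1 + 1 / (n : ℝ)) ^ n :=
        pow_le_pow_right₀ (le_add_of_nonneg_right (by positivity)) ht
    _ ≤ Real.exp (1 / n) ^ n := by
        gcongr
        linarith [Real.add_one_le_exp (1 / (n : ℝ))]
    _ = Real.exp 1 := by
        rw [← Real.exp_nat_mul, mul_one_div_cancel hn'.ne']

/-- Per-iterate bound on the SARAH estimators: under the NFG-SARAH epoch
recursion (with arbitrary points `x^0, …, x^n`), for every `0 ≤ t ≤ n - 1`,
`‖v^t‖² ≤ e ‖v^0‖² + (e L²/n) ∑_{k=1}^t ‖x^k - x^{k-1}‖²`. -/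
theorem nfg_sarah_estimator_norm_bound {n d : ℕ} (hn : 1 ≤ n) (hd : 1 ≤ d)
    (L : ℝ) (hL : 0 < L)
    (F : Fin n → EuclideanSpace ℝ (Fin d) → ℝ)
    (hdiff : ∀ i, Differentiable ℝ (F i))
    (hlip : ∀ i x y, ‖gradient (F i) x - gradient (F i) y‖ ≤ L * ‖x - y‖)
    (v : EuclideanSpace ℝ (Fin d)) (π : Equiv.Perm (Fin n))
    (x : ℕ → EuclideanSpace ℝ (Fin d)) (vt : ℕ → EuclideanSpace ℝ (Fin d))
    (hvt0 : vt 0 = v)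
    (hvt : ∀ t (ht : t < n),
      vt (t + 1) = vt t + (1 / (n : ℝ)) •
        (gradient (F (π ⟨t, ht⟩)) (x (t + 1)) - gradient (F (π ⟨t, ht⟩)) (x t))) :
    ∀ t, t ≤ n - 1 →
      ‖vt t‖ ^ 2 ≤ Real.exp 1 * ‖vt 0‖ ^ 2
        + (Real.exp 1 * L ^ 2 / (n : ℝ)) * ∑ k ∈ Finset.Icc 1 t, ‖x k - x (k - 1)‖ ^ 2 := by
  intro t ht
  have hn' : (0 : ℝ) < n := by exact_mod_cast hn
  have step : ∀ s < n, ‖vt (s + 1)‖ ^ 2 ≤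
      (1 + 1 / (n : ℝ)) * (‖vt s‖ ^ 2 + L ^ 2 / n * ‖x (s + 1) - x (s + 1 - 1)‖ ^ 2) := by
    intro s hs
    have hnorm : ‖vt (s + 1)‖ ≤ ‖vt s‖ + L * ‖x (s + 1) - x s‖ / n := by
      rw [hvt s hs]
      refine (norm_add_le _ _).trans ?_
      rw [norm_smul, Real.norm_of_nonneg (by positivity), one_div, inv_mul_eq_div]
      gcongr
      exact hlip _ _ _
    calc ‖vt (s + 1)‖ ^ 2 ≤ (‖vt s‖ + L * ‖x (s + 1) - x s‖ / n) ^ 2 := by gcongr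
      _ ≤ (1 + 1 / (n : ℝ)) * (‖vt s‖ ^ 2 + (L * ‖x (s + 1) - x s‖) ^ 2 / n) :=
        add_div_sq_le_one_add_inv_mul hn' _ _
      _ = _ := by
        rw [Nat.add_sub_cancel]
        ring
  have htn : t ≤ n := by omega
  calc ‖vt t‖ ^ 2
      ≤ (1 + 1 / (n : ℝ)) ^ t *
          (‖vt 0‖ ^ 2 + ∑ k ∈ Finset.Icc 1 t, L ^ 2 / n * ‖x k - x (k - 1)‖ ^ 2) :=
        le_pow_mul_add_sum_of_le_mul_add (a := fun s => ‖vt s‖ ^ 2)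
          (b := fun k => L ^ 2 / n * ‖x k - x (k - 1)‖ ^ 2)
          (le_add_of_nonneg_right (by positivity)) (fun k => by positivity) step t htn
    _ ≤ Real.exp 1 *
          (‖vt 0‖ ^ 2 + ∑ k ∈ Finset.Icc 1 t, L ^ 2 / n * ‖x k - x (k - 1)‖ ^ 2) := by
        gcongr
        exact one_add_one_div_pow_le_exp_one hn htn
    _ = _ := by
        rw [← Finset.mul_sum]
        ring
end

section
/- Consider one NFG-SARAH epoch with stepsize γ satisfying 0 < γ ≤ 1/(3L). Then the iterates satisfy ∑_{t=1}^{n} ‖x^t − x^{t−1}‖² ≤ (9/2)γ²n‖v‖². -/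
/-- In one NFG-SARAH epoch with stepsize `0 < γ ≤ 1/(3L)`, the sum of squared
consecutive-iterate differences satisfies
`∑_{t=1}^n ‖x^t - x^{t-1}‖² ≤ (9/2) γ² n ‖v‖²`. -/
theorem nfg_sarah_consecutive_drift {n d : ℕ} (hn : 1 ≤ n) (hd : 1 ≤ d)
    (L : ℝ) (hL : 0 < L)
    (F : Fin n → EuclideanSpace ℝ (Fin d) → ℝ)
    (hdiff : ∀ i, Differentiable ℝ (F i))
    (hlip : ∀ i x y, ‖gradient (F i) x - gradient (F i) y‖ ≤ L * ‖x - y‖)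
    (γ : ℝ) (hγ0 : 0 < γ) (hγ : γ ≤ 1 / (3 * L))
    (v : EuclideanSpace ℝ (Fin d)) (π : Equiv.Perm (Fin n))
    (x : ℕ → EuclideanSpace ℝ (Fin d)) (vt : ℕ → EuclideanSpace ℝ (Fin d))
    (hvt0 : vt 0 = v)
    (hvt : ∀ t (ht : t < n),
      vt (t + 1) = vt t + (1 / (n : ℝ)) •
        (gradient (F (π ⟨t, ht⟩)) (x (t + 1)) - gradient (F (π ⟨t, ht⟩)) (x t)))
    (hxt : ∀ t, t ≤ n → x (t + 1) = x t - γ • vt t) :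
    ∑ t ∈ Finset.Icc 1 n, ‖x t - x (t - 1)‖ ^ 2 ≤
      (9 / 2) * γ ^ 2 * (n : ℝ) * ‖v‖ ^ 2 := by
  have hn0 : (0 : ℝ) < n := by exact_mod_cast hn
  have hLγ : L * γ ≤ 1 / 3 := by
    rw [le_div_iff₀ (by positivity)] at hγ
    linarith
  have hstep : ∀ t ≤ n, ‖x (t + 1) - x t‖ = γ * ‖vt t‖ := by
    intro t ht
    rw [hxt t ht, sub_sub_cancel_left, norm_neg, norm_smul, Real.norm_of_nonneg hγ0.le]
  have hgrowth : ∀ t ≤ n, ‖vt t‖ ≤ Real.exp (t * (1 / (3 * n))) * ‖v‖ := by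
    intro t
    induction t with
    | zero => simp [hvt0]
    | succ t ih =>
      intro ht
      have hlt : t < n := ht
      calc ‖vt (t + 1)‖ ≤ ‖vt t‖ + 1 / n * (L * (γ * ‖vt t‖)) := by
            rw [hvt t hlt, ← hstep t hlt.le]
            refine (norm_add_le _ _).trans ?_
            rw [norm_smul, Real.norm_of_nonneg (by positivity : (0 : ℝ) ≤ 1 / n)]
            gcongr
            exact hlip _ _ _
        _ = ‖vt t‖ + 1 / n * (L * γ) * ‖vt t‖ := by ring
        _ ≤ ‖vt t‖ + 1 / n * (1 / 3) * ‖vt t‖ := by gcongr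
        _ = (1 / (3 * n) + 1) * ‖vt t‖ := by field_simp; ring
        _ ≤ Real.exp (1 / (3 * n)) * (Real.exp (t * (1 / (3 * n))) * ‖v‖) := by
            gcongr
            · exact Real.add_one_le_exp _
            · exact ih hlt.le
        _ = Real.exp ((t + 1 : ℕ) * (1 / (3 * n))) * ‖v‖ := by
            rw [← mul_assoc, ← Real.exp_add]
            push_cast
            ring_nf
  have hsq : ∀ t ≤ n, ‖vt t‖ ^ 2 ≤ 9 / 2 * ‖v‖ ^ 2 := by
    intro t ht
    have htn : (t : ℝ) ≤ n := by exact_mod_cast ht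
    calc ‖vt t‖ ^ 2 ≤ (Real.exp (t * (1 / (3 * n))) * ‖v‖) ^ 2 := by
          gcongr
          exact hgrowth t ht
      _ = Real.exp (2 * (t * (1 / (3 * n)))) * ‖v‖ ^ 2 := by
          rw [mul_pow, ← Real.exp_nat_mul]
          norm_num
      _ ≤ Real.exp 1 * ‖v‖ ^ 2 := by
          gcongr
          rw [mul_one_div, mul_div_assoc', div_le_one (by positivity)]
          linarith
      _ ≤ 9 / 2 * ‖v‖ ^ 2 := by
          gcongr
          linarith [Real.exp_one_lt_d9]
  calc ∑ t ∈ Finset.Icc 1 n, ‖x t - x (t - 1)‖ ^ 2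
      ≤ ∑ _t ∈ Finset.Icc 1 n, γ ^ 2 * (9 / 2 * ‖v‖ ^ 2) := by
        refine Finset.sum_le_sum fun t ht => ?_
        obtain ⟨h1, h2⟩ := Finset.mem_Icc.mp ht
        obtain ⟨s, rfl⟩ := Nat.exists_eq_add_of_le' h1
        rw [Nat.add_sub_cancel, hstep s (by omega), mul_pow]
        gcongr
        exact hsq s (by omega)
    _ = (9 / 2) * γ ^ 2 * (n : ℝ) * ‖v‖ ^ 2 := by
        rw [Finset.sum_const, Nat.card_Icc, Nat.add_sub_cancel, nsmul_eq_mul]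
        ring
end

section
/- Consider one NFG-SARAH epoch with stepsize γ satisfying 0 < γ ≤ 1/(3L). Then the iterates satisfy ∑_{t=1}^{n} ‖x^t − x^0‖² ≤ (9/2)γ²n³‖v‖². -/
/-- In one NFG-SARAH epoch with stepsize `0 < γ ≤ 1/(3L)`, the iterates stay
close to the starting point: `∑_{t=1}^n ‖x^t - x^0‖² ≤ (9/2) γ² n³ ‖v‖²`. -/
theorem nfg_sarah_iterate_drift {n d : ℕ} (hn : 1 ≤ n) (hd : 1 ≤ d)
    (L : ℝ) (hL : 0 < L)
    (F : Fin n → EuclideanSpace ℝ (Fin d) → ℝ)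
    (hdiff : ∀ i, Differentiable ℝ (F i))
    (hlip : ∀ i x y, ‖gradient (F i) x - gradient (F i) y‖ ≤ L * ‖x - y‖)
    (γ : ℝ) (hγ0 : 0 < γ) (hγ : γ ≤ 1 / (3 * L))
    (v : EuclideanSpace ℝ (Fin d)) (π : Equiv.Perm (Fin n))
    (x : ℕ → EuclideanSpace ℝ (Fin d)) (vt : ℕ → EuclideanSpace ℝ (Fin d))
    (hvt0 : vt 0 = v)
    (hvt : ∀ t (ht : t < n),
      vt (t + 1) = vt t + (1 / (n : ℝ)) •
        (gradient (F (π ⟨t, ht⟩)) (x (t + 1)) - gradient (F (π ⟨t, ht⟩)) (x t)))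
    (hxt : ∀ t, t ≤ n → x (t + 1) = x t - γ • vt t) :
    ∑ t ∈ Finset.Icc 1 n, ‖x t - x 0‖ ^ 2 ≤
      (9 / 2) * γ ^ 2 * (n : ℝ) ^ 3 * ‖v‖ ^ 2 := by
  have hn0 : (0 : ℝ) < n := by exact_mod_cast hn
  have hLγ : L * γ ≤ 1 / 3 := by
    rw [le_div_iff₀ (by positivity)] at hγ
    linarith
  have hstep : ∀ t ≤ n, ‖x (t + 1) - x t‖ = γ * ‖vt t‖ := by
    intro t ht
    rw [hxt t ht, sub_sub_cancel_left, norm_neg, norm_smul, Real.norm_of_nonneg hγ0.le]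
  have hv : ∀ t ≤ n, ‖vt t‖ ≤ (1 + t / (2 * n)) * ‖v‖ := by
    intro t
    induction t with
    | zero => intro _; simp [hvt0]
    | succ t ih =>
      intro ht
      have htn : (t : ℝ) / n ≤ 1 := by
        rw [div_le_one hn0]
        exact_mod_cast (by omega : t ≤ n)
      have hgrad := hlip (π ⟨t, ht⟩) (x (t + 1)) (x t)
      rw [hstep t (by omega)] at hgrad
      have hdelta : ‖gradient (F (π ⟨t, ht⟩)) (x (t + 1)) - gradient (F (π ⟨t, ht⟩)) (x t)‖
          ≤ 1 / 3 * ‖vt t‖ := by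
        refine hgrad.trans ?_
        rw [← mul_assoc]
        gcongr
      have hnext : ‖vt (t + 1)‖ ≤ (1 + 1 / n * (1 / 3)) * ‖vt t‖ := by
        rw [hvt t ht]
        refine (norm_add_le _ _).trans ?_
        rw [norm_smul, Real.norm_of_nonneg (by positivity), add_mul, one_mul, mul_assoc]
        gcongr
      refine hnext.trans ((mul_le_mul_of_nonneg_left (ih (by omega)) (by positivity)).trans ?_)
      rw [← mul_assoc]
      gcongr
      have hid : (1 + ((t + 1 : ℕ) : ℝ) / (2 * n)) - (1 + 1 / n * (1 / 3)) * (1 + t / (2 * n))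
          = 1 / (6 * n) * (1 - (t : ℝ) / n) := by
        push_cast
        field_simp
        ring
      have : 0 ≤ 1 / (6 * (n : ℝ)) * (1 - (t : ℝ) / n) :=
        mul_nonneg (by positivity) (by linarith)
      linarith
  have hvbound : ∀ t ≤ n, ‖vt t‖ ≤ 3 / 2 * ‖v‖ := by
    intro t ht
    refine (hv t ht).trans ?_
    gcongr
    have : (t : ℝ) / (2 * n) ≤ 1 / 2 := by
      rw [div_le_div_iff₀ (by positivity) (by norm_num)]
      have : (t : ℝ) ≤ n := by exact_mod_cast ht
      linarith
    linarith
  have hx : ∀ t ≤ n, ‖x t - x 0‖ ≤ t * (γ * (3 / 2 * ‖v‖)) := by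
    intro t
    induction t with
    | zero => intro _; simp
    | succ t ih =>
      intro ht
      have htri := norm_sub_le_norm_sub_add_norm_sub (x (t + 1)) (x t) (x 0)
      rw [hstep t (by omega)] at htri
      have hmul := mul_le_mul_of_nonneg_left (hvbound t (by omega)) hγ0.le
      have := ih (by omega)
      push_cast
      linarith
  have hterm : ∀ t ∈ Finset.Icc 1 n, ‖x t - x 0‖ ^ 2 ≤ (n * (γ * (3 / 2 * ‖v‖))) ^ 2 := by
    intro t ht
    have ht' := (Finset.mem_Icc.mp ht).2
    have := hx t ht'
    gcongr
    exact this.trans (by gcongr)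
  refine (Finset.sum_le_card_nsmul _ _ _ hterm).trans ?_
  rw [Nat.card_Icc, Nat.add_sub_cancel, nsmul_eq_mul]
  have : 0 ≤ γ ^ 2 * (n : ℝ) ^ 3 * ‖v‖ ^ 2 := by positivity
  linarith
end

section
/- Assume f is bounded below with f* = inf f, and run the NFG-SARAH algorithm with stepsize γ satisfying 0 < γ ≤ 1/(20L(n+1)). Then for every number of epochs S ≥ 1, the averaged squared gradient norm satisfies (1/S)∑_{s=1}^{S} ‖∇f(x_s^0)‖² ≤ (4/(γ(n+1)S))·(f(x_1^0) − f*). -/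
section

variable {E : Type*} [NormedAddCommGroup E] [InnerProductSpace ℝ E]

theorem gradient_average [CompleteSpace E] {n : ℕ} {F : Fin n → E → ℝ}
    (hF : ∀ i, Differentiable ℝ (F i)) {f : E → ℝ}
    (hf : ∀ z, f z = (1 / (n : ℝ)) * ∑ i, F i z) (z : E) :
    HasGradientAt f ((1 / (n : ℝ)) • ∑ i, gradient (F i) z) z := by
  have h : HasFDerivAt (fun z => (1 / (n : ℝ)) * ∑ i, F i z)
      ((1 / (n : ℝ)) • ∑ i, fderiv ℝ (F i) z) z :=
    (HasFDerivAt.fun_sum fun i _ => (hF i z).hasFDerivAt).const_mul _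
  rw [hasGradientAt_iff_hasFDerivAt, funext hf]
  simpa [gradient, map_smul, map_sum] using h

/-- Quadratic upper bound from a Lipschitz gradient, with constant `L` in place of the
optimal `L / 2`. -/
theorem le_add_inner_add_of_lipschitz_gradient [CompleteSpace E] {f : E → ℝ} {G : E → E} {L : ℝ}
    (hL : 0 ≤ L) (hf : ∀ z, HasGradientAt f (G z) z)
    (hG : ∀ y z, ‖G y - G z‖ ≤ L * ‖y - z‖) (y z : E) :
    f z ≤ f y + inner ℝ (G y) (z - y) + L * ‖z - y‖ ^ 2 := by
  have h := Convex.norm_image_sub_le_of_norm_hasFDerivWithin_le'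
    (f := f) (s := segment ℝ y z) (C := L * ‖z - y‖)
    (f' := fun w => InnerProductSpace.toDual ℝ E (G w)) (φ := InnerProductSpace.toDual ℝ E (G y))
    (fun w _ => (hf w).hasFDerivAt.hasFDerivWithinAt)
    (fun w hw => by
      rw [← map_sub, LinearIsometryEquiv.norm_map]
      refine (hG w y).trans (mul_le_mul_of_nonneg_left ?_ hL)
      obtain ⟨θ, ⟨h0, h1⟩, rfl⟩ := (segment_eq_image' ℝ y z) ▸ hw
      simp only [add_sub_cancel_left, norm_smul, Real.norm_eq_abs, abs_of_nonneg h0]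
      exact mul_le_of_le_one_left (norm_nonneg _) h1)
    (convex_segment y z) (left_mem_segment ℝ y z) (right_mem_segment ℝ y z)
  rw [InnerProductSpace.toDual_apply_apply, Real.norm_eq_abs] at h
  nlinarith [le_of_abs_le h]

theorem norm_inv_smul_sum_le {ι : Type*} (s : Finset ι) (u : ι → E) {B c : ℝ} (hc : 0 < c)
    (hcard : (s.card : ℝ) = c) (hu : ∀ i ∈ s, ‖u i‖ ≤ B) :
    ‖(1 / c) • ∑ i ∈ s, u i‖ ≤ B := by
  rw [norm_smul, Real.norm_eq_abs, abs_of_pos (one_div_pos.2 hc), one_div, inv_mul_le_iff₀ hc]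
  exact (norm_sum_le_of_le s hu).trans_eq (by simp [hcard])

/-- A single epoch of the recursive gradient estimator: `w` are the estimators, `y` the iterates,
and `g t` the component gradient used at inner step `t + 1`. -/
structure IsSarahEpoch (n : ℕ) (L γ : ℝ) (g : Fin n → E → E) (y w : ℕ → E) : Prop where
  n_pos : 0 < n
  L_pos : 0 < L
  stepsize_pos : 0 < γ
  stepsize_le : L * (γ * (n + 1)) ≤ 1 / 20
  lipschitz : ∀ i a b, ‖g i a - g i b‖ ≤ L * ‖a - b‖
  estimator_succ : ∀ t (ht : t < n),
    w (t + 1) = w t + (1 / (n : ℝ)) • (g ⟨t, ht⟩ (y (t + 1)) - g ⟨t, ht⟩ (y t))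
  iterate_succ : ∀ t, t ≤ n → y (t + 1) = y t - γ • w t

namespace IsSarahEpoch

variable {n : ℕ} {L γ : ℝ} {g : Fin n → E → E} {y w : ℕ → E}

theorem stepsize_le_div (h : IsSarahEpoch n L γ g y w) : L * γ ≤ 1 / 40 := by
  have hn : (1 : ℝ) ≤ n := by exact_mod_cast h.n_pos
  nlinarith [h.stepsize_le, mul_pos h.L_pos h.stepsize_pos]

theorem norm_iterate_sub (h : IsSarahEpoch n L γ g y w) {t : ℕ} (ht : t ≤ n) :
    ‖y (t + 1) - y t‖ = γ * ‖w t‖ := by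
  rw [h.iterate_succ t ht, sub_sub_cancel_left, norm_neg, norm_smul, Real.norm_eq_abs,
    abs_of_pos h.stepsize_pos]

theorem norm_estimator_sub_le (h : IsSarahEpoch n L γ g y w) {t : ℕ} (ht : t ≤ n) :
    ‖w t - w 0‖ ≤ ‖w 0‖ / 39 := by
  have hn : (0 : ℝ) < n := by exact_mod_cast h.n_pos
  have aux : ∀ t : ℕ, t ≤ n → ‖w t - w 0‖ ≤ (t / n : ℝ) * (‖w 0‖ / 39) := by
    intro t
    induction t with
    | zero => simp
    | succ t ih =>
      intro ht
      have hs := ih (by omega)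
      have hle : (t / n : ℝ) ≤ 1 := by
        rw [div_le_one hn]; exact_mod_cast (by omega : t ≤ n)
      have hw : ‖w t‖ ≤ 40 / 39 * ‖w 0‖ := by
        have := norm_le_norm_add_norm_sub' (w t) (w 0)
        have := mul_le_of_le_one_left (by positivity : 0 ≤ ‖w 0‖ / 39) hle
        linarith
      have hd : ‖w (t + 1) - w t‖ ≤ (1 / n : ℝ) * (‖w 0‖ / 39) := by
        rw [h.estimator_succ t ht, add_sub_cancel_left, norm_smul, Real.norm_eq_abs,
          abs_of_pos (one_div_pos.2 hn)]
        refine mul_le_mul_of_nonneg_left ?_ (by positivity)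
        refine (h.lipschitz _ _ _).trans ?_
        rw [h.norm_iterate_sub (by omega), ← mul_assoc]
        calc L * γ * ‖w t‖ ≤ 1 / 40 * (40 / 39 * ‖w 0‖) :=
              mul_le_mul h.stepsize_le_div hw (norm_nonneg _) (by norm_num)
          _ = ‖w 0‖ / 39 := by ring
      have := norm_sub_le_norm_sub_add_norm_sub (w (t + 1)) (w t) (w 0)
      calc ‖w (t + 1) - w 0‖ ≤ (1 / n : ℝ) * (‖w 0‖ / 39) + (t / n : ℝ) * (‖w 0‖ / 39) := by
            linarith
        _ = ((t + 1 : ℕ) / n : ℝ) * (‖w 0‖ / 39) := by push_cast; ring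
  refine (aux t ht).trans (mul_le_of_le_one_left (by positivity) ?_)
  rw [div_le_one hn]; exact_mod_cast ht

theorem norm_estimator_le (h : IsSarahEpoch n L γ g y w) {t : ℕ} (ht : t ≤ n) :
    ‖w t‖ ≤ 40 / 39 * ‖w 0‖ := by
  have := norm_le_norm_add_norm_sub' (w t) (w 0)
  linarith [h.norm_estimator_sub_le ht]

theorem norm_last_sub_le (h : IsSarahEpoch n L γ g y w) {t : ℕ} (ht : t ≤ n + 1) :
    L * ‖y (n + 1) - y t‖ ≤ 2 / 39 * ‖w 0‖ := by
  have hd := dist_le_Ico_sum_of_dist_le (f := y) ht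
    (d := fun _ => γ * (40 / 39 * ‖w 0‖)) (fun {k} _ hk => by
      rw [dist_comm, dist_eq_norm, h.norm_iterate_sub (by omega)]
      exact mul_le_mul_of_nonneg_left (h.norm_estimator_le (by omega)) h.stepsize_pos.le)
  rw [dist_comm, dist_eq_norm, Finset.sum_const, Nat.card_Ico, nsmul_eq_mul] at hd
  have hc : ((n + 1 - t : ℕ) : ℝ) ≤ n + 1 := by exact_mod_cast Nat.sub_le _ _
  have hpos : 0 ≤ γ * (40 / 39 * ‖w 0‖) := mul_nonneg h.stepsize_pos.le (by positivity)
  calc L * ‖y (n + 1) - y t‖ ≤ L * ((n + 1) * (γ * (40 / 39 * ‖w 0‖))) :=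
        mul_le_mul_of_nonneg_left (hd.trans (mul_le_mul_of_nonneg_right hc hpos)) h.L_pos.le
    _ = L * (γ * (n + 1)) * (40 / 39 * ‖w 0‖) := by ring
    _ ≤ 1 / 20 * (40 / 39 * ‖w 0‖) := mul_le_mul_of_nonneg_right h.stepsize_le (by positivity)
    _ = 2 / 39 * ‖w 0‖ := by ring

theorem norm_average_sub_le (h : IsSarahEpoch n L γ g y w) :
    ‖(1 / (n : ℝ)) • ∑ t, g t (y (n + 1)) - (1 / (n : ℝ)) • ∑ t : Fin n, g t (y (t + 1))‖
      ≤ 2 / 39 * ‖w 0‖ := by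
  rw [← smul_sub, ← Finset.sum_sub_distrib]
  refine norm_inv_smul_sum_le _ _ (by exact_mod_cast h.n_pos) (by simp) fun t _ => ?_
  exact (h.lipschitz _ _ _).trans (h.norm_last_sub_le (by omega))

theorem last_sub_first (h : IsSarahEpoch n L γ g y w) :
    y (n + 1) - y 0 =
      -((γ * (n + 1)) • ((1 / ((n : ℝ) + 1)) • ∑ t ∈ Finset.range (n + 1), w t)) := by
  have hn : (n : ℝ) + 1 ≠ 0 := by positivity
  rw [smul_smul, mul_assoc, mul_one_div_cancel hn, mul_one, Finset.smul_sum,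
    ← Finset.sum_neg_distrib, ← Finset.sum_range_sub]
  refine Finset.sum_congr rfl fun t ht => ?_
  rw [h.iterate_succ t (by simpa [Nat.lt_succ_iff] using ht), sub_sub_cancel_left]

theorem descent [CompleteSpace E] (h : IsSarahEpoch n L γ g y w) {f : E → ℝ} {G : E → E}
    (hf : ∀ z, HasGradientAt f (G z) z) (hG : ∀ a b, ‖G a - G b‖ ≤ L * ‖a - b‖) :
    f (y (n + 1)) + γ * (n + 1) * (2 / 39 * ‖w 0‖) ^ 2 ≤
      f (y 0) + γ * (n + 1) * ‖G (y 0) - w 0‖ ^ 2 - γ * (n + 1) / 2 * ‖G (y 0)‖ ^ 2 := by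
  have hq := le_add_inner_add_of_lipschitz_gradient h.L_pos.le hf hG (y 0) (y (n + 1))
  set V := (1 / ((n : ℝ) + 1)) • ∑ t ∈ Finset.range (n + 1), w t with hV
  have hVw : ‖V - w 0‖ ≤ ‖w 0‖ / 39 := by
    have hn : (n : ℝ) + 1 ≠ 0 := by positivity
    have : V - w 0 = (1 / ((n : ℝ) + 1)) • ∑ t ∈ Finset.range (n + 1), (w t - w 0) := by
      rw [Finset.sum_sub_distrib, smul_sub, ← hV, Finset.sum_const, Finset.card_range,
        ← Nat.cast_smul_eq_nsmul ℝ, smul_smul, Nat.cast_succ, one_div_mul_cancel hn, one_smul]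
    rw [this]
    refine norm_inv_smul_sum_le _ _ (by positivity) (by simp) fun t ht => ?_
    exact h.norm_estimator_sub_le (by simpa [Nat.lt_succ_iff] using ht)
  have hc : 0 < γ * (n + 1) := mul_pos h.stepsize_pos (by positivity)
  have hLc := h.stepsize_le
  rw [h.last_sub_first, ← hV] at hq
  generalize γ * ((n : ℝ) + 1) = c at *
  rw [inner_neg_right, real_inner_smul_right, norm_neg, norm_smul, Real.norm_eq_abs,
    abs_of_pos hc] at hq
  have hGV : ‖G (y 0) - V‖ ≤ ‖G (y 0) - w 0‖ + ‖w 0‖ / 39 := by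
    have := norm_sub_le_norm_sub_add_norm_sub (G (y 0)) (w 0) V
    rw [norm_sub_rev (w 0) V] at this
    linarith
  have hwV : 38 / 39 * ‖w 0‖ ≤ ‖V‖ := by
    have := norm_le_norm_add_norm_sub' (w 0) V
    rw [norm_sub_rev] at this
    linarith
  have hexp := norm_sub_sq_real (G (y 0)) V
  have hsq : ‖G (y 0) - V‖ ^ 2 ≤ 2 * ‖G (y 0) - w 0‖ ^ 2 + 2 * (‖w 0‖ / 39) ^ 2 := by
    nlinarith [pow_le_pow_left₀ (norm_nonneg _) hGV 2,
      sq_nonneg (‖G (y 0) - w 0‖ - ‖w 0‖ / 39)]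
  have hVsq : (38 / 39 * ‖w 0‖) ^ 2 ≤ ‖V‖ ^ 2 := pow_le_pow_left₀ (by positivity) hwV 2
  have hquad : L * (c * ‖V‖) ^ 2 ≤ c * (1 / 20 * ‖V‖ ^ 2) := by
    nlinarith [mul_le_mul_of_nonneg_right hLc (by positivity : 0 ≤ c * ‖V‖ ^ 2)]
  have key : (2 / 39 * ‖w 0‖) ^ 2 + 1 / 20 * ‖V‖ ^ 2 - inner ℝ (G (y 0)) V ≤
      ‖G (y 0) - w 0‖ ^ 2 - 1 / 2 * ‖G (y 0)‖ ^ 2 := by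
    nlinarith [sq_nonneg ‖w 0‖]
  nlinarith [mul_le_mul_of_nonneg_left key hc.le]

end IsSarahEpoch

end


/-- Theorem 3 (NFG-SARAH, non-convex): if `f` is bounded below with infimum `f*`,
then for the NFG-SARAH algorithm with stepsize `0 < γ ≤ 1/(20 L (n+1))`, the
averaged squared gradient norm over the first `S` epochs satisfies
`(1/S) ∑_{s=1}^S ‖∇f(x_s^0)‖² ≤ (4/(γ (n+1) S)) (f(x_1^0) - f*)`. -/
theorem nfg_sarah_nonconvex {n d : ℕ} (hn : 1 ≤ n) (hd : 1 ≤ d)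
    (L : ℝ) (hL : 0 < L)
    (F : Fin n → EuclideanSpace ℝ (Fin d) → ℝ)
    (hdiff : ∀ i, Differentiable ℝ (F i))
    (hlip : ∀ i x y, ‖gradient (F i) x - gradient (F i) y‖ ≤ L * ‖x - y‖)
    (f : EuclideanSpace ℝ (Fin d) → ℝ)
    (hf : ∀ z, f z = (1 / (n : ℝ)) * ∑ i, F i z)
    (fstar : ℝ) (hfstar : IsGLB (Set.range f) fstar)
    (γ : ℝ) (hγ0 : 0 < γ) (hγ : γ ≤ 1 / (20 * L * ((n : ℝ) + 1)))
    -- the NFG-SARAH algorithm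
    (v : ℕ → EuclideanSpace ℝ (Fin d))
    (x : ℕ → ℕ → EuclideanSpace ℝ (Fin d)) (vt : ℕ → ℕ → EuclideanSpace ℝ (Fin d))
    (π : ℕ → Equiv.Perm (Fin n))
    (hv0 : v 0 = 0)
    (hvt0 : ∀ s, vt s 0 = v s)
    (hvt : ∀ s t (ht : t < n),
      vt s (t + 1) = vt s t + (1 / (n : ℝ)) •
        (gradient (F (π s ⟨t, ht⟩)) (x s (t + 1))
          - gradient (F (π s ⟨t, ht⟩)) (x s t)))
    (hxt : ∀ s t, t ≤ n → x s (t + 1) = x s t - γ • vt s t)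
    (hxs : ∀ s, x (s + 1) 0 = x s (n + 1))
    (hvs : ∀ s, v (s + 1) =
      (1 / (n : ℝ)) • ∑ t : Fin n, gradient (F (π s t)) (x s (t + 1)))
    (S : ℕ) (hS : 1 ≤ S) :
    (1 / (S : ℝ)) * ∑ s ∈ Finset.Icc 1 S, ‖gradient f (x s 0)‖ ^ 2 ≤
      (4 / (γ * ((n : ℝ) + 1) * S)) * (f (x 1 0) - fstar) := by
  have hnpos : (0 : ℝ) < n := by exact_mod_cast hn
  set G : EuclideanSpace ℝ (Fin d) → EuclideanSpace ℝ (Fin d) :=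
    fun z => (1 / (n : ℝ)) • ∑ i, gradient (F i) z with hG
  have hgrad : ∀ z, HasGradientAt f (G z) z := gradient_average hdiff hf
  have hGlip : ∀ a b, ‖G a - G b‖ ≤ L * ‖a - b‖ := fun a b => by
    rw [hG, ← smul_sub, ← Finset.sum_sub_distrib]
    exact norm_inv_smul_sum_le _ _ hnpos (by simp) fun i _ => hlip i a b
  have hGperm : ∀ s z, G z = (1 / (n : ℝ)) • ∑ t, gradient (F (π s t)) z := fun s z => by
    rw [hG, Equiv.sum_comp (π s) fun i => gradient (F i) z]
  have hepoch : ∀ s, IsSarahEpoch n L γ (fun t => gradient (F (π s t))) (x s) (vt s) := fun s =>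
    { n_pos := hn
      L_pos := hL
      stepsize_pos := hγ0
      stepsize_le := by
        rw [le_div_iff₀ (by positivity)] at hγ
        linarith
      lipschitz := fun t => hlip (π s t)
      estimator_succ := hvt s
      iterate_succ := hxt s }
  have herr : ∀ s, ‖G (x (s + 1) 0) - vt (s + 1) 0‖ ≤ 2 / 39 * ‖vt s 0‖ := fun s => by
    rw [hvt0 (s + 1), hvs, hxs, hGperm s]
    exact (hepoch s).norm_average_sub_le
  have hinit : ‖G (x 1 0) - vt 1 0‖ = 0 :=
    le_antisymm (by simpa [hvt0 0, hv0] using herr 0) (norm_nonneg _)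
  set c : ℝ := γ * ((n : ℝ) + 1) with hc
  have hcpos : 0 < c := by positivity
  have hsum : ∀ S, c / 2 * ∑ s ∈ Finset.Icc 1 S, ‖G (x s 0)‖ ^ 2 +
      (f (x (S + 1) 0) + c * ‖G (x (S + 1) 0) - vt (S + 1) 0‖ ^ 2) ≤ f (x 1 0) := by
    intro S
    induction S with
    | zero => simp [hinit]
    | succ S ih =>
      rw [Finset.sum_Icc_succ_top (by omega)]
      have hdesc := (hepoch (S + 1)).descent hgrad hGlip
      rw [← hc, ← hxs] at hdesc
      have := mul_le_mul_of_nonneg_left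
        (pow_le_pow_left₀ (norm_nonneg _) (herr (S + 1)) 2) hcpos.le
      linarith
  have hlow : fstar ≤ f (x (S + 1) 0) := hfstar.1 ⟨_, rfl⟩
  have hgap : 0 ≤ f (x 1 0) - fstar := sub_nonneg.2 (hfstar.1 ⟨_, rfl⟩)
  have hSpos : (0 : ℝ) < S := by exact_mod_cast hS
  simp only [fun z => (hgrad z).gradient]
  rw [one_div_mul_eq_div, div_mul_eq_mul_div, div_le_div_iff₀ hSpos (by positivity)]
  have hmain : c * ∑ s ∈ Finset.Icc 1 S, ‖G (x s 0)‖ ^ 2 ≤ 4 * (f (x 1 0) - fstar) := by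
    have := hsum S
    have : 0 ≤ c * ‖G (x (S + 1) 0) - vt (S + 1) 0‖ ^ 2 := by positivity
    linarith
  nlinarith [mul_le_mul_of_nonneg_right hmain hSpos.le]
end

section
/- Assume additionally that each f_i is μ-strongly convex for some 0 < μ ≤ L, that n ≥ 2, and run the NFG-SARAH algorithm with stepsize γ satisfying 0 < γ ≤ 1/(20L(n+1)). Let f* = min f. Then for every S ≥ 1, f(x_{S+1}^0) − f* ≤ (1 − γμ(n+1)/2)^S · (f(x_1^0) − f*). -/
open scoped RealInnerProductSpace

section StronglyConvex

variable {E : Type*} [NormedAddCommGroup E] [InnerProductSpace ℝ E]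

/-- The Polyak–Łojasiewicz inequality, from the strong convexity inequality between two points. -/
lemma two_mul_sub_le_norm_sq_of_strongly_convex {μ a b : ℝ} (hμ : 0 < μ) {g z : E}
    (h : a + ⟪g, z⟫ + μ / 2 * ‖z‖ ^ 2 ≤ b) : 2 * μ * (a - b) ≤ ‖g‖ ^ 2 := by
  have h1 : 0 ≤ ‖g + μ • z‖ ^ 2 := sq_nonneg _
  rw [norm_add_sq_real, inner_smul_right, norm_smul, Real.norm_of_nonneg hμ.le] at h1
  nlinarith [mul_le_mul_of_nonneg_left h (by positivity : 0 ≤ 2 * μ)]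

/-- A convex function with `L`-Lipschitz (sub)gradient satisfies a quadratic upper bound. -/
lemma le_add_inner_add_of_convex_of_lipschitz {f : E → ℝ} {g : E → E} {L : ℝ}
    (hconv : ∀ x y, f x + ⟪g x, y - x⟫ ≤ f y) (hlip : ∀ x y, ‖g x - g y‖ ≤ L * ‖x - y‖)
    (x y : E) : f y ≤ f x + ⟪g x, y - x⟫ + L * ‖y - x‖ ^ 2 := by
  have h1 := hconv y x
  have h2 : ⟪g y, x - y⟫ = -⟪g x, y - x⟫ - ⟪g y - g x, y - x⟫ := by
    rw [← neg_sub y x, inner_neg_right, inner_sub_left]; ring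
  have h3 := real_inner_le_norm (g y - g x) (y - x)
  nlinarith [mul_le_mul_of_nonneg_right (hlip y x) (norm_nonneg (y - x))]

/-- One step `x ↦ x - η • w` with `w` close to `v` contracts the Lyapunov function
`Δ + 2 * η * ‖G - v‖ ^ 2`. -/
lemma lyapunov_contraction {η L μ Δ Δ' e' : ℝ} {G v w : E} (hη : 0 < η) (hμ : 0 < μ)
    (hμL : μ ≤ L) (hηL : η * L ≤ 1 / 20) (hΔ : 0 ≤ Δ)
    (hdesc : Δ' ≤ Δ - η * ⟪G, w⟫ + L * η ^ 2 * ‖w‖ ^ 2)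
    (hPL : 2 * μ * Δ ≤ ‖G‖ ^ 2) (hw : ‖w - v‖ ≤ 1 / 30 * ‖v‖)
    (he0 : 0 ≤ e') (he : e' ≤ 31 / 600 * ‖v‖) :
    Δ' + 2 * η * e' ^ 2 ≤ (1 - η * μ / 2) * (Δ + 2 * η * ‖G - v‖ ^ 2) := by
  have hin : ⟪G, w⟫ = (‖G‖ ^ 2 + ‖w‖ ^ 2 - ‖G - w‖ ^ 2) / 2 := by
    rw [norm_sub_sq_real]; ring
  have h1 : ‖G - w‖ ≤ ‖G - v‖ + 1 / 30 * ‖v‖ := by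
    have := norm_sub_le_norm_sub_add_norm_sub G v w
    rw [norm_sub_rev v w] at this
    linarith
  have h2 : 29 / 30 * ‖v‖ ≤ ‖w‖ := by
    have := norm_sub_norm_le v w
    rw [norm_sub_rev v w] at this
    linarith
  have hv := norm_nonneg v
  have h1' : ‖G - w‖ ^ 2 ≤ 2 * ‖G - v‖ ^ 2 + 2 / 900 * ‖v‖ ^ 2 := by
    have := pow_le_pow_left₀ (norm_nonneg _) h1 2
    nlinarith [sq_nonneg (‖G - v‖ - 1 / 30 * ‖v‖)]
  have h2' : (29 / 30) ^ 2 * ‖v‖ ^ 2 ≤ ‖w‖ ^ 2 := by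
    rw [← mul_pow]; exact pow_le_pow_left₀ (by positivity) h2 2
  have he' : e' ^ 2 ≤ (31 / 600) ^ 2 * ‖v‖ ^ 2 := by
    rw [← mul_pow]; exact pow_le_pow_left₀ he0 he 2
  have hημ : η * μ ≤ 1 / 20 := (mul_le_mul_of_nonneg_left hμL hη.le).trans hηL
  have hLw : L * η ^ 2 * ‖w‖ ^ 2 ≤ η * (1 / 20 * ‖w‖ ^ 2) := by
    nlinarith [mul_le_mul_of_nonneg_right hηL (by positivity : 0 ≤ η * ‖w‖ ^ 2)]
  have hμe : μ * η * ‖G - v‖ ^ 2 ≤ 1 / 20 * ‖G - v‖ ^ 2 := by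
    rw [mul_comm μ]; gcongr
  have hμΔ : 0 ≤ μ * Δ := by positivity
  have key : -⟪G, w⟫ + 1 / 20 * ‖w‖ ^ 2 + 2 * e' ^ 2
      ≤ - (μ / 2 * Δ) + 2 * ‖G - v‖ ^ 2 - μ * η * ‖G - v‖ ^ 2 := by
    rw [hin]
    nlinarith [sq_nonneg ‖v‖, sq_nonneg ‖G - v‖]
  nlinarith [mul_le_mul_of_nonneg_left key hη.le]

end StronglyConvex

section Epoch

variable {E : Type*} [NormedAddCommGroup E] [NormedSpace ℝ E] {n : ℕ} {L γ : ℝ}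

/-- The recursive gradient estimator stays close to its initial value during an epoch. -/
lemma norm_recursive_estimator_sub_le (hn : 0 < n) (hγ : 0 ≤ γ)
    (hγL : γ * L ≤ 1 / 60) {g : ℕ → E → E} {u y : ℕ → E}
    (hlip : ∀ t < n, ∀ a b, ‖g t a - g t b‖ ≤ L * ‖a - b‖)
    (hu : ∀ t < n, u (t + 1) = u t + (1 / (n : ℝ)) • (g t (y (t + 1)) - g t (y t)))
    (hy : ∀ t ≤ n, y (t + 1) = y t - γ • u t) {t : ℕ} (ht : t ≤ n) :
    ‖u t - u 0‖ ≤ 1 / 30 * ‖u 0‖ := by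
  have hn' : (0 : ℝ) < n := by exact_mod_cast hn
  have main : ∀ t ≤ n, ‖u t - u 0‖ ≤ t / n * (1 / 30 * ‖u 0‖) := by
    intro t
    induction t with
    | zero => intro _; simp
    | succ t ih =>
      intro ht
      have ih := ih (by omega)
      have htn : (t : ℝ) / n ≤ 1 := by
        rw [div_le_one hn']; exact_mod_cast (by omega : t ≤ n)
      have h1 : ‖u t‖ ≤ 2 * ‖u 0‖ := by
        have h2 := norm_le_norm_add_norm_sub' (u t) (u 0)
        have h3 := mul_le_mul_of_nonneg_right htn (by positivity : 0 ≤ 1 / 30 * ‖u 0‖)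
        linarith [norm_nonneg (u 0)]
      have h4 : ‖g t (y (t + 1)) - g t (y t)‖ ≤ 1 / 30 * ‖u 0‖ := by
        refine (hlip t (by omega) _ _).trans ?_
        rw [hy t (by omega), sub_sub_cancel_left, norm_neg, norm_smul, Real.norm_of_nonneg hγ]
        calc L * (γ * ‖u t‖) = γ * L * ‖u t‖ := by ring
          _ ≤ 1 / 60 * (2 * ‖u 0‖) := by gcongr
          _ = _ := by ring
      calc ‖u (t + 1) - u 0‖
          = ‖(u t - u 0) + (1 / (n : ℝ)) • (g t (y (t + 1)) - g t (y t))‖ := by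
            rw [hu t (by omega)]; congr 1; abel
        _ ≤ t / n * (1 / 30 * ‖u 0‖) + 1 / n * (1 / 30 * ‖u 0‖) := by
            refine (norm_add_le _ _).trans (add_le_add ih ?_)
            rw [norm_smul, Real.norm_of_nonneg (by positivity)]
            gcongr
        _ = _ := by push_cast; ring
  refine (main t ht).trans ?_
  have htn : (t : ℝ) / n ≤ 1 := by
    rw [div_le_one hn']; exact_mod_cast ht
  simpa using mul_le_mul_of_nonneg_right htn (by positivity : 0 ≤ 1 / 30 * ‖u 0‖)

/-- The distance from an inner iterate to the last one, for bounded directions. -/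
lemma norm_iterate_sub_le (hγ : 0 ≤ γ) {u y : ℕ → E} {B : ℝ} (hB : 0 ≤ B)
    (hu : ∀ t ≤ n, ‖u t‖ ≤ B) (hy : ∀ t ≤ n, y (t + 1) = y t - γ • u t) {k : ℕ}
    (hk : k ≤ n + 1) : ‖y (n + 1) - y k‖ ≤ γ * (n + 1) * B := by
  have h := dist_le_Ico_sum_of_dist_le (f := y) (d := fun _ => γ * B) hk
    (fun {t} _ ht => by
      rw [dist_eq_norm, hy t (by omega), sub_sub_cancel, norm_smul, Real.norm_of_nonneg hγ]
      exact mul_le_mul_of_nonneg_left (hu t (by omega)) hγ)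
  rw [dist_comm, dist_eq_norm] at h
  refine h.trans ?_
  rw [Finset.sum_const, Nat.card_Ico, nsmul_eq_mul]
  calc ((n + 1 - k : ℕ) : ℝ) * (γ * B) ≤ ((n + 1 : ℕ) : ℝ) * (γ * B) := by
        gcongr; omega
    _ = _ := by push_cast; ring

/-- An epoch is a single step along the average direction. -/
lemma iterate_eq_sub_sum {u y : ℕ → E} (hy : ∀ t ≤ n, y (t + 1) = y t - γ • u t) {k : ℕ}
    (hk : k ≤ n + 1) : y k = y 0 - γ • ∑ t ∈ Finset.range k, u t := by
  induction k with
  | zero => simp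
  | succ k ih =>
    rw [hy k (by omega), ih (by omega), Finset.sum_range_succ, smul_add]; abel

lemma norm_smul_sum_sub_le {u : ℕ → E} {c : ℝ} {a : E} {m : ℕ} (hm : 0 < m)
    (hu : ∀ t < m, ‖u t - a‖ ≤ c) :
    ‖(1 / (m : ℝ)) • ∑ t ∈ Finset.range m, u t - a‖ ≤ c := by
  have hm' : (0 : ℝ) < m := by exact_mod_cast hm
  have h1 : (1 / (m : ℝ)) • ∑ t ∈ Finset.range m, u t - a
      = (1 / (m : ℝ)) • ∑ t ∈ Finset.range m, (u t - a) := by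
    rw [Finset.sum_sub_distrib, smul_sub, Finset.sum_const, Finset.card_range,
      ← Nat.cast_smul_eq_nsmul ℝ, smul_smul, one_div_mul_cancel hm'.ne', one_smul]
  rw [h1, norm_smul, Real.norm_of_nonneg (by positivity)]
  have h2 : ‖∑ t ∈ Finset.range m, (u t - a)‖ ≤ m * c := by
    refine (norm_sum_le_of_le _ fun t ht => hu t (Finset.mem_range.1 ht)).trans ?_
    simp
  calc 1 / (m : ℝ) * ‖∑ t ∈ Finset.range m, (u t - a)‖ ≤ 1 / m * (m * c) := by gcongr
    _ = c := by field_simp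

end Epoch

lemma norm_average_sub_average_le {E : Type*} [NormedAddCommGroup E] [NormedSpace ℝ E]
    {n : ℕ} (hn : 0 < n) {a b : Fin n → E} {c : ℝ} (h : ∀ i, ‖a i - b i‖ ≤ c) :
    ‖(1 / (n : ℝ)) • ∑ i, a i - (1 / (n : ℝ)) • ∑ i, b i‖ ≤ c := by
  have hn' : (0 : ℝ) < n := by exact_mod_cast hn
  rw [← smul_sub, ← Finset.sum_sub_distrib, norm_smul, Real.norm_of_nonneg (by positivity)]
  have h2 : ‖∑ i, (a i - b i)‖ ≤ n * c := by
    refine (norm_sum_le_of_le _ fun i _ => h i).trans ?_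
    simp
  calc 1 / (n : ℝ) * ‖∑ i, (a i - b i)‖ ≤ 1 / n * (n * c) := by gcongr
    _ = c := by field_simp

/-- Theorem 4 (NFG-SARAH, strongly convex): if each `f_i` is `μ`-strongly convex
with `0 < μ ≤ L` and `n ≥ 2`, then NFG-SARAH with `0 < γ ≤ 1/(20 L (n+1))`
converges linearly: `f(x_{S+1}^0) - f* ≤ (1 - γ μ (n+1) / 2)^S (f(x_1^0) - f*)`. -/
theorem nfg_sarah_strongly_convex {n d : ℕ} (hn : 2 ≤ n) (hd : 1 ≤ d)
    (L μ : ℝ) (hL : 0 < L) (hμ0 : 0 < μ) (hμL : μ ≤ L)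
    (F : Fin n → EuclideanSpace ℝ (Fin d) → ℝ)
    (hdiff : ∀ i, Differentiable ℝ (F i))
    (hlip : ∀ i x y, ‖gradient (F i) x - gradient (F i) y‖ ≤ L * ‖x - y‖)
    (hsc : ∀ i x y, F i y ≥
      F i x + ⟪gradient (F i) x, y - x⟫ + (μ / 2) * ‖y - x‖ ^ 2)
    (f : EuclideanSpace ℝ (Fin d) → ℝ)
    (hf : ∀ z, f z = (1 / (n : ℝ)) * ∑ i, F i z)
    (fstar : ℝ) (hfstar : IsLeast (Set.range f) fstar)
    (γ : ℝ) (hγ0 : 0 < γ) (hγ : γ ≤ 1 / (20 * L * ((n : ℝ) + 1)))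
    -- the NFG-SARAH algorithm
    (v : ℕ → EuclideanSpace ℝ (Fin d))
    (x : ℕ → ℕ → EuclideanSpace ℝ (Fin d)) (vt : ℕ → ℕ → EuclideanSpace ℝ (Fin d))
    (π : ℕ → Equiv.Perm (Fin n))
    (hv0 : v 0 = 0)
    (hvt0 : ∀ s, vt s 0 = v s)
    (hvt : ∀ s t (ht : t < n),
      vt s (t + 1) = vt s t + (1 / (n : ℝ)) •
        (gradient (F (π s ⟨t, ht⟩)) (x s (t + 1))
          - gradient (F (π s ⟨t, ht⟩)) (x s t)))
    (hxt : ∀ s t, t ≤ n → x s (t + 1) = x s t - γ • vt s t)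
    (hxs : ∀ s, x (s + 1) 0 = x s (n + 1))
    (hvs : ∀ s, v (s + 1) =
      (1 / (n : ℝ)) • ∑ t : Fin n, gradient (F (π s t)) (x s (t + 1)))
    (S : ℕ) (hS : 1 ≤ S) :
    f (x (S + 1) 0) - fstar ≤
      (1 - γ * μ * ((n : ℝ) + 1) / 2) ^ S * (f (x 1 0) - fstar) := by
  have hn0 : 0 < n := by omega
  have hn' : (0 : ℝ) < n := by exact_mod_cast hn0
  have hn2 : (2 : ℝ) ≤ n := by exact_mod_cast hn
  obtain ⟨η, hηdef⟩ : ∃ η : ℝ, η = γ * ((n : ℝ) + 1) := ⟨_, rfl⟩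
  have hη : 0 < η := by rw [hηdef]; positivity
  have hηL : η * L ≤ 1 / 20 := by
    rw [le_div_iff₀ (by positivity)] at hγ
    rw [hηdef]; linarith
  have hγL : γ * L ≤ 1 / 60 := by
    have : 3 * (γ * L) ≤ η * L := by
      rw [hηdef]; nlinarith [mul_pos hγ0 hL]
    linarith
  obtain ⟨g, hg⟩ : ∃ g : EuclideanSpace ℝ (Fin d) → EuclideanSpace ℝ (Fin d),
      ∀ z, g z = (1 / (n : ℝ)) • ∑ i, gradient (F i) z := ⟨_, fun _ => rfl⟩
  have hglip : ∀ a b, ‖g a - g b‖ ≤ L * ‖a - b‖ := fun a b => by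
    rw [hg, hg]
    exact norm_average_sub_average_le hn0 fun i => hlip i a b
  have hgsc : ∀ a b, f a + ⟪g a, b - a⟫ + μ / 2 * ‖b - a‖ ^ 2 ≤ f b := by
    intro a b
    have hsum := Finset.sum_le_sum fun i (_ : i ∈ Finset.univ) => hsc i a b
    rw [Finset.sum_add_distrib, Finset.sum_add_distrib, Finset.sum_const, Finset.card_univ,
      Fintype.card_fin, nsmul_eq_mul, ← sum_inner] at hsum
    have hsum := mul_le_mul_of_nonneg_left hsum (by positivity : 0 ≤ 1 / (n : ℝ))
    rw [hf a, hf b, hg, real_inner_smul_left]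
    refine le_trans (le_of_eq ?_) hsum
    field_simp
  have hgconv : ∀ a b, f a + ⟪g a, b - a⟫ ≤ f b := fun a b => by
    have := hgsc a b
    have : 0 ≤ μ / 2 * ‖b - a‖ ^ 2 := by positivity
    linarith
  obtain ⟨⟨z, hz⟩, hmin⟩ := hfstar
  have hdev : ∀ s, ∀ t ≤ n, ‖vt s t - v s‖ ≤ 1 / 30 * ‖v s‖ := by
    intro s t ht
    rw [← hvt0 s]
    refine norm_recursive_estimator_sub_le hn0 hγ0.le hγL
      (g := fun t => if h : t < n then gradient (F (π s ⟨t, h⟩)) else 0)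
      (fun t ht a b => ?_) (fun t ht => ?_) (fun t ht => hxt s t ht) ht
    · simpa only [dif_pos ht] using hlip _ a b
    · simpa only [dif_pos ht] using hvt s t ht
  have herr : ∀ s, ‖g (x (s + 1) 0) - v (s + 1)‖ ≤ 31 / 600 * ‖v s‖ := by
    intro s
    have h1 : g (x (s + 1) 0)
        = (1 / (n : ℝ)) • ∑ t : Fin n, gradient (F (π s t)) (x s (n + 1)) := by
      rw [hg, hxs s]
      congr 1
      exact (Equiv.sum_comp (π s) fun i => gradient (F i) (x s (n + 1))).symm
    rw [h1, hvs s]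
    refine norm_average_sub_average_le hn0 fun t => (hlip _ _ _).trans ?_
    have h2 : ‖x s (n + 1) - x s (t + 1)‖ ≤ η * (31 / 30 * ‖v s‖) := by
      refine hηdef ▸ norm_iterate_sub_le hγ0.le (by positivity) (fun k hk => ?_) (hxt s) (by omega)
      have h3 := norm_le_norm_add_norm_sub' (vt s k) (v s)
      linarith [hdev s k hk]
    calc L * ‖x s (n + 1) - x s (t + 1)‖ ≤ L * (η * (31 / 30 * ‖v s‖)) := by gcongr
      _ = η * L * (31 / 30 * ‖v s‖) := by ring
      _ ≤ 1 / 20 * (31 / 30 * ‖v s‖) := by gcongr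
      _ = _ := by ring
  have hstep : ∀ s, f (x (s + 1) 0) - fstar + 2 * η * ‖g (x (s + 1) 0) - v (s + 1)‖ ^ 2 ≤
      (1 - η * μ / 2) * (f (x s 0) - fstar + 2 * η * ‖g (x s 0) - v s‖ ^ 2) := by
    intro s
    obtain ⟨w, hw⟩ : ∃ w, w = (1 / ((n + 1 : ℕ) : ℝ)) • ∑ t ∈ Finset.range (n + 1), vt s t :=
      ⟨_, rfl⟩
    have hxw : x (s + 1) 0 - x s 0 = -(η • w) := by
      rw [hxs s, iterate_eq_sub_sum (hxt s) le_rfl, hw, smul_smul, hηdef, sub_sub_cancel_left]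
      congr 2
      push_cast
      field_simp
    refine lyapunov_contraction (w := w) hη hμ0 hμL hηL (sub_nonneg.2 (hmin ⟨_, rfl⟩)) ?_ ?_ ?_
      (norm_nonneg _) (herr s)
    · have h := le_add_inner_add_of_convex_of_lipschitz hgconv hglip (x s 0) (x (s + 1) 0)
      rw [hxw, inner_neg_right, real_inner_smul_right, norm_neg, norm_smul,
        Real.norm_of_nonneg hη.le] at h
      linarith
    · have h := hgsc (x s 0) z
      rw [hz] at h
      exact two_mul_sub_le_norm_sq_of_strongly_convex hμ0 h
    · rw [hw]
      exact norm_smul_sum_sub_le n.succ_pos fun t ht => hdev s t (by omega)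
  have hημ : η * μ ≤ 1 / 20 := (mul_le_mul_of_nonneg_left hμL hη.le).trans hηL
  have hiter : ∀ k, f (x (k + 1) 0) - fstar + 2 * η * ‖g (x (k + 1) 0) - v (k + 1)‖ ^ 2 ≤
      (1 - η * μ / 2) ^ k * (f (x 1 0) - fstar) := by
    intro k
    induction k with
    | zero =>
      have h1 := herr 0
      rw [hv0, norm_zero, mul_zero] at h1
      simp [le_antisymm h1 (norm_nonneg _)]
    | succ k ih =>
      refine (hstep (k + 1)).trans ?_
      rw [pow_succ' _ k, mul_assoc (1 - η * μ / 2)]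
      have h0 : 0 ≤ 1 - η * μ / 2 := by linarith
      exact mul_le_mul_of_nonneg_left ih h0
  have h := hiter S
  have hnn : 0 ≤ 2 * η * ‖g (x (S + 1) 0) - v (S + 1)‖ ^ 2 := by positivity
  have hfin : γ * μ * ((n : ℝ) + 1) / 2 = η * μ / 2 := by rw [hηdef]; ring
  rw [hfin]
  linarith
end
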